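/- Let f, g : ℝⁿ → ℝ be differentiable with gradients ∇f, ∇g (Euclidean inner product), let Ω ⊆ ℝⁿ be a nonempty closed convex set with metric projection P_Ω, let λ > 0, σ ∈ (0,1), L̄ ≥ 0, and t₀ < t₁. Let x : ℝ → ℝⁿ be differentiable on [t₀,t₁] with x(t₀) = xᵏ ∈ Ω, x′(t) = P_Ω(x(t) − λ(∇f(x(t)) + ∇g(xᵏ))) − x(t) for all t ∈ [t₀,t₁], and suppose x(t) ∈ Ω for all t ∈ [t₀,t₁]. Define z̄(t) = P_Ω(x(t) − λ(∇f(x(t)) + ∇g(xᵏ))) − x(t). If for all t ∈ [t₀,t₁] one has ‖∇g(x(t)) − ∇g(xᵏ)‖ ≤ L̄‖x(t) − xᵏ‖ and λL̄‖x(t) − xᵏ‖ ≤ σ‖z̄(t)‖, then the map t ↦ f(x(t)) + g(x(t)) is nonincreasing on [t₀,t₁]. -/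

import Mathlib

open scoped RealInnerProductSpace in
/-- The obtuse-angle characterization of a nearest point in a convex set. -/
theorem inner_sub_nearest_nonpos {E : Type*} [NormedAddCommGroup E] [InnerProductSpace ℝ E]
    {K : Set E} (hK : Convex ℝ K) {u p : E} (hp : p ∈ K)
    (hmin : ∀ v ∈ K, ‖u - p‖ ≤ ‖u - v‖) {w : E} (hw : w ∈ K) : ⟪u - p, w - p⟫ ≤ 0 := by
  have : Nonempty K := ⟨⟨p, hp⟩⟩
  refine (norm_eq_iInf_iff_real_inner_le_zero hK hp).1 (le_antisymm ?_ ?_) w hw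
  · exact le_ciInf fun v => hmin v v.2
  · exact ciInf_le (f := fun v : K => ‖u - v‖)
      ⟨0, by rintro _ ⟨v, rfl⟩; exact norm_nonneg _⟩ ⟨p, hp⟩

open scoped RealInnerProductSpace in
/-- The displacement of a projected gradient step makes an obtuse angle with any vector close
enough, relative to the step length, to the direction used in the step. -/
theorem inner_projected_step_nonpos {E : Type*} [NormedAddCommGroup E] [InnerProductSpace ℝ E]
    {K : Set E} (hK : Convex ℝ K) {y d e p : E} {c σ : ℝ} (hc : 0 < c) (hσ : σ ≤ 1)
    (hy : y ∈ K) (hp : p ∈ K) (hmin : ∀ v ∈ K, ‖y - c • d - p‖ ≤ ‖y - c • d - v‖)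
    (he : c * ‖e - d‖ ≤ σ * ‖p - y‖) : ⟪e, p - y⟫ ≤ 0 := by
  have hvar := inner_sub_nearest_nonpos hK hp hmin hy
  have hexp : ⟪y - c • d - p, y - p⟫ = c * ⟪d, p - y⟫ + ‖p - y‖ ^ 2 := by
    rw [show y - c • d - p = -(c • d + (p - y)) by abel, show y - p = -(p - y) by abel,
      inner_neg_neg, inner_add_left, real_inner_smul_left, real_inner_self_eq_norm_sq]
  have hcs := mul_le_mul_of_nonneg_left (real_inner_le_norm (e - d) (p - y)) hc.le
  have herr := mul_le_mul_of_nonneg_right he (norm_nonneg (p - y))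
  rw [inner_sub_left] at hcs
  have hsq := mul_nonneg (sub_nonneg.2 hσ) (sq_nonneg ‖p - y‖)
  exact nonpos_of_mul_nonpos_right (by nlinarith : c * ⟪e, p - y⟫ ≤ 0) hc


theorem stmt13 (n : ℕ) (f g : EuclideanSpace ℝ (Fin n) → ℝ)
    (f' g' : EuclideanSpace ℝ (Fin n) → EuclideanSpace ℝ (Fin n))
    (hf : ∀ y, HasGradientAt f (f' y) y) (hg : ∀ y, HasGradientAt g (g' y) y)
    (Ω : Set (EuclideanSpace ℝ (Fin n)))
    (hne : Ω.Nonempty) (hcl : IsClosed Ω) (hconv : Convex ℝ Ω)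
    (P : EuclideanSpace ℝ (Fin n) → EuclideanSpace ℝ (Fin n))
    (hPmem : ∀ u, P u ∈ Ω)
    (hPproj : ∀ u, ∀ v ∈ Ω, ‖u - P u‖ ≤ ‖u - v‖)
    (lam σ Lbar : ℝ) (hlam : 0 < lam) (hσ : σ ∈ Set.Ioo (0 : ℝ) 1) (hL : 0 ≤ Lbar)
    (t₀ t₁ : ℝ) (ht : t₀ < t₁) (x : ℝ → EuclideanSpace ℝ (Fin n))
    (hx0 : x t₀ ∈ Ω)
    (hx : ∀ t ∈ Set.Icc t₀ t₁,
      HasDerivAt x (P (x t - lam • (f' (x t) + g' (x t₀))) - x t) t)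
    (hxΩ : ∀ t ∈ Set.Icc t₀ t₁, x t ∈ Ω)
    (hLip : ∀ t ∈ Set.Icc t₀ t₁,
      ‖g' (x t) - g' (x t₀)‖ ≤ Lbar * ‖x t - x t₀‖)
    (htrig : ∀ t ∈ Set.Icc t₀ t₁,
      lam * Lbar * ‖x t - x t₀‖ ≤ σ * ‖P (x t - lam • (f' (x t) + g' (x t₀))) - x t‖) :
    AntitoneOn (fun t => f (x t) + g (x t)) (Set.Icc t₀ t₁) := by
  have hderiv : ∀ t ∈ Set.Icc t₀ t₁, HasDerivAt (fun t => f (x t) + g (x t))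
      (inner ℝ (f' (x t) + g' (x t)) (P (x t - lam • (f' (x t) + g' (x t₀))) - x t)) t := by
    intro t ht
    rw [inner_add_left]
    exact ((hf (x t)).hasFDerivAt.comp_hasDerivAt t (hx t ht)).add
      ((hg (x t)).hasFDerivAt.comp_hasDerivAt t (hx t ht))
  refine antitoneOn_of_hasDerivWithinAt_nonpos (convex_Icc t₀ t₁)
    (fun t ht => (hderiv t ht).continuousAt.continuousWithinAt)
    (fun t ht => (hderiv t (interior_subset ht)).hasDerivWithinAt) fun t ht => ?_
  replace ht := interior_subset ht
  refine inner_projected_step_nonpos hconv hlam hσ.2.le (hxΩ t ht) (hPmem _) (hPproj _) ?_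
  rw [add_sub_add_left_eq_sub]
  calc lam * ‖g' (x t) - g' (x t₀)‖ ≤ lam * (Lbar * ‖x t - x t₀‖) :=
        mul_le_mul_of_nonneg_left (hLip t ht) hlam.le
    _ = lam * Lbar * ‖x t - x t₀‖ := (mul_assoc _ _ _).symm
    _ ≤ _ := htrig t ht
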